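/- Let x and ξ_in be square-integrable random vectors in ℂ^N with x_in := x + ξ_in, assume E[⟨x, ξ_in⟩] = 0 and 0 < E[‖ξ_in‖²] < ∞, and let f̂ := E[x | x_in] be the conditional expectation of x given the σ-algebra generated by x_in (taken componentwise, so f̂ achieves the minimum mean squared error among σ(x_in)-measurable estimators). Then E[⟨ξ_in, f̂⟩] = E[‖f̂ − x‖²]; consequently, the Gram–Schmidt orthogonalization coefficient of the MMSE prototype equals the ratio of its MSE to the input error power: B := E[⟨ξ_in, f̂⟩] / E[‖ξ_in‖²] = v_f̂ / v_in, where v_f̂ := (1/N)·E[‖f̂ − x‖²] and v_in := (1/N)·E[‖ξ_in‖²]. -/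

import Mathlib

open MeasureTheory
open scoped ComplexInnerProductSpace

/-- The pointwise inner product of square-integrable vectors is integrable. -/
theorem integrable_inner_aux {Ω : Type*} {mΩ : MeasurableSpace Ω} {μ : Measure Ω}
    {N : ℕ} {f g : Ω → EuclideanSpace ℂ (Fin N)} (hf : MemLp f 2 μ) (hg : MemLp g 2 μ) :
    Integrable (fun ω => ⟪f ω, g ω⟫) μ := by
  refine Integrable.mono' (hf.norm.integrable_mul hg.norm) (hf.1.inner hg.1) ?_
  exact Filter.Eventually.of_forall fun ω => norm_inner_le_norm _ _

/-- Orthogonality principle in integrated form. -/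
theorem integral_inner_condExp_aux {Ω : Type*} {mΩ : MeasurableSpace Ω} {μ : Measure Ω}
    [IsProbabilityMeasure μ] {N : ℕ} {m : MeasurableSpace Ω} (hm : m ≤ mΩ)
    {g x : Ω → EuclideanSpace ℂ (Fin N)} (hg : StronglyMeasurable[m] g)
    (hg2 : MemLp g 2 μ) (hx : MemLp x 2 μ) :
    ∫ ω, ⟪g ω, (μ[x|m]) ω⟫ ∂μ = ∫ ω, ⟪g ω, x ω⟫ ∂μ := by
  have hB := isBoundedBilinearMap_inner (𝕜 := ℂ) (E := EuclideanSpace ℂ (Fin N))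
  have hint : Integrable (fun ω => ⟪g ω, x ω⟫) μ := integrable_inner_aux hg2 hx
  have h := condExp_bilin_of_stronglyMeasurable_left hB.toContinuousLinearMap (μ := μ) hg
    (g := x) hint (hx.integrable (by norm_num))
  rw [← integral_condExp hm (f := fun ω => ⟪g ω, x ω⟫)]
  exact (integral_congr_ae h).symm

/-- For the MMSE prototype `f̂ = E[x | x_in]` (conditional expectation of
the signal given the observation `x_in = x + ξ_in`, where `E[⟪x, ξ_in⟫] = 0`), one has
`E[⟪ξ_in, f̂⟫] = E[‖f̂ − x‖²]`; hence the GSO coefficient equals the ratio of the MMSE to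
the input error power: `B = v_f̂ / v_in`. -/
theorem gso_coefficient_mmse_prototype
    {Ω : Type*} [MeasureSpace Ω] [IsProbabilityMeasure (volume : Measure Ω)]
    (N : ℕ) (hN : 0 < N)
    [MeasurableSpace (EuclideanSpace ℂ (Fin N))]
    [BorelSpace (EuclideanSpace ℂ (Fin N))]
    (x ξin : Ω → EuclideanSpace ℂ (Fin N))
    (hx : MemLp x 2 (volume : Measure Ω))
    (hξin : MemLp ξin 2 (volume : Measure Ω))
    (xin : Ω → EuclideanSpace ℂ (Fin N))
    (hxin : xin = fun ω => x ω + ξin ω)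
    (hxin_meas : Measurable xin)
    (horth : (∫ ω, ⟪x ω, ξin ω⟫) = 0)
    (hpos : 0 < ∫ ω, ‖ξin ω‖ ^ 2)
    (fhat : Ω → EuclideanSpace ℂ (Fin N))
    (hfhat : fhat = MeasureTheory.condExp
      (MeasurableSpace.comap xin inferInstance) (volume : Measure Ω) x)
    (B : ℂ)
    (hB : B = (∫ ω, ⟪ξin ω, fhat ω⟫) / ((∫ ω, ‖ξin ω‖ ^ 2 : ℝ) : ℂ))
    (vf vin : ℝ)
    (hvf : vf = (1 / (N : ℝ)) * ∫ ω, ‖fhat ω - x ω‖ ^ 2)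
    (hvin : vin = (1 / (N : ℝ)) * ∫ ω, ‖ξin ω‖ ^ 2) :
    (∫ ω, ⟪ξin ω, fhat ω⟫) = ((∫ ω, ‖fhat ω - x ω‖ ^ 2 : ℝ) : ℂ)
      ∧ B = ((vf / vin : ℝ) : ℂ) := by
  have hm : MeasurableSpace.comap xin inferInstance ≤ (inferInstance : MeasurableSpace Ω) :=
    hxin_meas.comap_le
  have hf2 : MemLp fhat 2 (volume : Measure Ω) := by
    rw [hfhat]; exact hx.condExp (by norm_num)
  have hxin2 : MemLp xin 2 (volume : Measure Ω) := by
    rw [hxin]; exact hx.add hξin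
  have hxm : StronglyMeasurable[MeasurableSpace.comap xin inferInstance] xin :=
    (comap_measurable xin).stronglyMeasurable
  have hfm : StronglyMeasurable[MeasurableSpace.comap xin inferInstance] fhat := by
    rw [hfhat]; exact stronglyMeasurable_condExp
  have h1 : ∫ ω, ⟪xin ω, fhat ω⟫ = ∫ ω, ⟪xin ω, x ω⟫ := by
    have := integral_inner_condExp_aux hm hxm hxin2 hx
    rwa [← hfhat] at this
  have h2 : ∫ ω, ⟪fhat ω, fhat ω⟫ = ∫ ω, ⟪fhat ω, x ω⟫ := by
    have := integral_inner_condExp_aux hm hfm hf2 hx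
    rwa [← hfhat] at this
  have h3 : ∫ ω, ⟪ξin ω, x ω⟫ = 0 := by
    have h := integral_conj (μ := (volume : Measure Ω)) (f := fun ω => ⟪x ω, ξin ω⟫)
    simp only [inner_conj_symm] at h
    rw [h, horth, map_zero]
  have ixf := integrable_inner_aux hx hf2
  have ixx := integrable_inner_aux hx hx
  have iff' := integrable_inner_aux hf2 hf2
  have ifx := integrable_inner_aux hf2 hx
  have iξf := integrable_inner_aux hξin hf2
  have iξx := integrable_inner_aux hξin hx
  have h4 : ∫ ω, ⟪xin ω, fhat ω⟫ = (∫ ω, ⟪x ω, fhat ω⟫) + ∫ ω, ⟪ξin ω, fhat ω⟫ := by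
    rw [← integral_add ixf iξf]; simp only [hxin, inner_add_left]
  have h5 : ∫ ω, ⟪xin ω, x ω⟫ = (∫ ω, ⟪x ω, x ω⟫) + ∫ ω, ⟪ξin ω, x ω⟫ := by
    rw [← integral_add ixx iξx]; simp only [hxin, inner_add_left]
  have h6 : ((∫ ω, ‖fhat ω - x ω‖ ^ 2 : ℝ) : ℂ) =
      ((∫ ω, ⟪fhat ω, fhat ω⟫) - ∫ ω, ⟪fhat ω, x ω⟫) -
        ((∫ ω, ⟪x ω, fhat ω⟫) - ∫ ω, ⟪x ω, x ω⟫) := by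
    rw [← integral_sub iff' ifx, ← integral_sub ixf ixx,
      ← integral_sub (f := fun ω => ⟪fhat ω, fhat ω⟫ - ⟪fhat ω, x ω⟫)
        (g := fun ω => ⟪x ω, fhat ω⟫ - ⟪x ω, x ω⟫) (iff'.sub ifx) (ixf.sub ixx),
      ← integral_complex_ofReal]
    refine integral_congr_ae (Filter.Eventually.of_forall fun ω => ?_)
    have := inner_self_eq_norm_sq_to_K (𝕜 := ℂ) (fhat ω - x ω)
    simp only [inner_sub_left, inner_sub_right] at this
    simp only [Complex.ofReal_pow]
    refine Eq.trans this.symm ?_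
    ring
  have key : (∫ ω, ⟪ξin ω, fhat ω⟫) = ((∫ ω, ‖fhat ω - x ω‖ ^ 2 : ℝ) : ℂ) := by
    rw [h6]
    linear_combination h1 - h4 + h5 + h3 - h2
  refine ⟨key, ?_⟩
  have hN' : (N : ℝ) ≠ 0 := by positivity
  rw [hB, key, ← Complex.ofReal_div, hvf, hvin, mul_div_mul_left _ _ (by positivity)]
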